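/- (Main theorem.) Assume (2k+1) divides (n−2k) and that P̂(X_0 | y_{-k}^k) has all entries in [0,1] whenever p(y_{-k}^k) > 0. Then for every ε > Λ_max·(3ε* + M·δ/2), Pr( |L_{X̂^δ}(x^n, Y^n) − D^k_{x^n}| > ε ) ≤ 2·(2k+1)·(1/δ + 1)^M · exp( −(2(n−2k)/(2k+1)) · (ε − Λ_max·(3ε* + M·δ/2))² / Λ_max² ), where the probability is over Y^n. -/

import Mathlib

open MeasureTheory Finset

noncomputable section
namespace GenCUDE

/-- The center index of a `(2k+1)`-tuple (0-indexed position `k`). -/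
def center (k : ℕ) : Fin (2*k+1) := ⟨k, by omega⟩

/-- Remove the center coordinate of a `(2k+1)`-tuple, yielding the context (a `2k`-tuple). -/
def dropCenter {α : Type*} (k : ℕ) (y : Fin (2*k+1) → α) : Fin (2*k) → α :=
  fun i => y ((center k).succAbove i)

/-- `p(y_{-k}^k)`: the joint output density of the full `(2k+1)`-tuple. -/
def pFull {M k : ℕ} (f : Fin M → ℝ → ℝ) (P : (Fin (2*k+1) → Fin M) → ℝ)
    (y : Fin (2*k+1) → ℝ) : ℝ :=
  ∑ u : Fin (2*k+1) → Fin M, P u * ∏ j, f (u j) (y j)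

/-- `p(y_{-0})`: the output density of the context. -/
def pCtx {M k : ℕ} (f : Fin M → ℝ → ℝ) (P : (Fin (2*k+1) → Fin M) → ℝ)
    (c : Fin (2*k) → ℝ) : ℝ :=
  ∑ u : Fin (2*k+1) → Fin M, P u * ∏ i, f (dropCenter k u i) (c i)

/-- `p(a, y_{-k}^k)`. -/
def pJoint {M k : ℕ} (f : Fin M → ℝ → ℝ) (P : (Fin (2*k+1) → Fin M) → ℝ)
    (a : Fin M) (y : Fin (2*k+1) → ℝ) : ℝ :=
  ∑ u : Fin (2*k+1) → Fin M,
    (if u (center k) = a then P u * ∏ j, f (u j) (y j) else 0)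

/-- `p(a, y_{-0})`. -/
def pJointCtx {M k : ℕ} (f : Fin M → ℝ → ℝ) (P : (Fin (2*k+1) → Fin M) → ℝ)
    (a : Fin M) (c : Fin (2*k) → ℝ) : ℝ :=
  ∑ u : Fin (2*k+1) → Fin M,
    (if u (center k) = a then P u * ∏ i, f (dropCenter k u i) (c i) else 0)

/-- `P(X_0 = · | y_{-k}^k)`. -/
def postFull {M k : ℕ} (f : Fin M → ℝ → ℝ) (P : (Fin (2*k+1) → Fin M) → ℝ)
    (y : Fin (2*k+1) → ℝ) : Fin M → ℝ :=
  fun a => pJoint f P a y / pFull f P y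

/-- `P(X_0 = · | y_{-0})`. -/
def postCtx {M k : ℕ} (f : Fin M → ℝ → ℝ) (P : (Fin (2*k+1) → Fin M) → ℝ)
    (c : Fin (2*k) → ℝ) : Fin M → ℝ :=
  fun a => pJointCtx f P a c / pCtx f P c

/-- `P(Z_0 = · | y_{-0}) = Σ_a P(X_0=a | y_{-0}) Π(a,·)`. -/
def PZ {M k : ℕ} (f : Fin M → ℝ → ℝ) (P : (Fin (2*k+1) → Fin M) → ℝ)
    (Pi : Matrix (Fin M) (Fin M) ℝ) (c : Fin (2*k) → ℝ) : Fin M → ℝ :=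
  fun z => ∑ a, postCtx f P c a * Pi a z

/-- The approximate posterior `P̂(X_0 = · | y_{-k}^k)` built from the network output `g`. -/
def postHat {M k : ℕ} (f : Fin M → ℝ → ℝ) (P : (Fin (2*k+1) → Fin M) → ℝ)
    (Pi : Matrix (Fin M) (Fin M) ℝ) (g : (Fin (2*k) → ℝ) → Fin M → ℝ)
    (y : Fin (2*k+1) → ℝ) : Fin M → ℝ :=
  fun a => (pCtx f P (dropCenter k y) / pFull f P y)
      * (∑ z, g (dropCenter k y) z * Pi⁻¹ z a) * f a (y (center k))

/-- `b` is a Bayes response with respect to (the not necessarily normalized vector) `v`. -/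
def IsBayes {M : ℕ} (Λ : Matrix (Fin M) (Fin M) ℝ) (v : Fin M → ℝ) (b : Fin M) : Prop :=
  ∀ c : Fin M, ∑ a, Λ a b * v a ≤ ∑ a, Λ a c * v a

/-- Single-letter risk `R(h)` of a sliding-window rule `h` under `P ⊗ C`. -/
def risk {M k : ℕ} (f : Fin M → ℝ → ℝ) (P : (Fin (2*k+1) → Fin M) → ℝ)
    (Λ : Matrix (Fin M) (Fin M) ℝ) (h : (Fin (2*k+1) → ℝ) → Fin M) : ℝ :=
  ∑ u : Fin (2*k+1) → Fin M,
    P u * ∫ y : Fin (2*k+1) → ℝ, Λ (u (center k)) (h y) * ∏ j, f (u j) (y j)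

/-- Extend a `Fin n`-indexed sequence to `ℕ` by zero. -/
def ext {n : ℕ} (y : Fin n → ℝ) : ℕ → ℝ := fun m => if h : m < n then y ⟨m, h⟩ else 0

/-- The window `y_{i-k}^{i+k}` (0-indexed center `i`). -/
def window (k : ℕ) (y : ℕ → ℝ) (i : ℕ) : Fin (2*k+1) → ℝ := fun j => y (i - k + j.val)

/-- The empirical distribution of `(2k+1)`-blocks of `x^n` (0-indexed positions `0,…,n-1`). -/
def empDist (M n k : ℕ) (x : ℕ → Fin M) : (Fin (2*k+1) → Fin M) → ℝ :=
  fun u => (((Finset.Ico k (n - k)).filter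
      fun i => ∀ j : Fin (2*k+1), x (i - k + j.val) = u j).card : ℝ) / ((n - 2*k : ℕ) : ℝ)

/-- The law of `Y^n`: independent coordinates, `Y_i` with density `f_{x_i}`. -/
def lawSeq {M : ℕ} (n : ℕ) (f : Fin M → ℝ → ℝ) (x : ℕ → Fin M) : Measure (Fin n → ℝ) :=
  Measure.pi fun i : Fin n => volume.withDensity fun t => ENNReal.ofReal (f (x i.val) t)

/-- The joint law of the `(2k+1)` noisy outputs under `P ⊗ C`. -/
def lawBlock {M k : ℕ} (f : Fin M → ℝ → ℝ) (P : (Fin (2*k+1) → Fin M) → ℝ) :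
    Measure (Fin (2*k+1) → ℝ) :=
  ∑ u : Fin (2*k+1) → Fin M, ENNReal.ofReal (P u) •
    Measure.pi fun j => volume.withDensity fun t => ENNReal.ofReal (f (u j) t)

/-- The average loss of the sliding-window rule `h` on `(x^n, y^n)`. -/
def avgLoss {M : ℕ} (n k : ℕ) (Λ : Matrix (Fin M) (Fin M) ℝ) (x : ℕ → Fin M)
    (h : (Fin (2*k+1) → ℝ) → Fin M) (y : Fin n → ℝ) : ℝ :=
  (((n - 2*k : ℕ) : ℝ))⁻¹ * ∑ i ∈ Finset.Ico k (n - k), Λ (x i) (h (window k (ext y) i))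

open ProbabilityTheory

lemma indep_curry {ι κ Ω : Type*} [MeasurableSpace Ω] {P : Measure Ω}
    {X : ι → κ → Ω → ℝ} (mX : ∀ i j, Measurable (X i j))
    (h : iIndepFun (fun (p : (_ : ι) × κ) ω => X p.1 p.2 ω) P) :
    iIndepFun (fun i ω => (fun j => X i j ω)) P := by
  have := h.isProbabilityMeasure
  have : ∀ i j, IsProbabilityMeasure (P.map (X i j)) :=
    fun i j ↦ Measure.isProbabilityMeasure_map (mX i j).aemeasurable
  have : ∀ i, IsProbabilityMeasure (P.map (fun ω ↦ (X i · ω))) :=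
    fun i ↦ Measure.isProbabilityMeasure_map (Measurable.aemeasurable (by fun_prop))
  have h2 : ∀ i, iIndepFun (X i) P := fun i =>
    h.precomp (g := fun j => (⟨i, j⟩ : (_ : ι) × κ)) (by intro a b hab; simpa using hab)
  have e : (MeasurableEquiv.piCurry (fun _ _ => ℝ)) ∘ (fun ω (p : (_ : ι) × κ) ↦ X p.1 p.2 ω)
      = fun ω i j ↦ X i j ω := by
    ext; simp [Sigma.curry]
  rw [iIndepFun_iff_map_fun_eq_infinitePi_map (by fun_prop), ← e,
    ← Measure.map_map (by fun_prop) (by fun_prop),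
    (iIndepFun_iff_map_fun_eq_infinitePi_map (by fun_prop)).1 h,
    Measure.infinitePi_map_piCurry (fun i j ↦ P.map (X i j))]
  congrm Measure.infinitePi fun i ↦ ?_
  rw [(iIndepFun_iff_map_fun_eq_infinitePi_map (by fun_prop)).1 (h2 i)]

lemma pi_wd {ι : Type*} [Fintype ι] (f : ι → ℝ → ℝ) (hm : ∀ i, Measurable (f i))
    (h0 : ∀ i t, 0 ≤ f i t) (hi : ∀ i, Integrable (f i)) :
    Measure.pi (fun i => volume.withDensity fun t => ENNReal.ofReal (f i t))
      = (volume : Measure (ι → ℝ)).withDensity fun y => ENNReal.ofReal (∏ i, f i (y i)) := by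
  have : ∀ i, SigmaFinite ((volume : Measure ℝ).withDensity fun t => ENNReal.ofReal (f i t)) := by
    intro i
    have := isFiniteMeasure_withDensity_ofReal (hi i).2
    infer_instance
  refine Measure.pi_eq fun s hs => ?_
  rw [withDensity_apply _ (MeasurableSet.univ_pi hs)]
  have key : ∀ i, ∫⁻ t in s i, ENNReal.ofReal (f i t) = ENNReal.ofReal (∫ t in s i, f i t) := by
    intro i
    rw [ofReal_integral_eq_lintegral_ofReal (hi i).integrableOn (ae_of_all _ (h0 i))]
  simp_rw [withDensity_apply _ (hs _), key]
  rw [← ofReal_integral_eq_lintegral_ofReal, ← ENNReal.ofReal_prod_of_nonneg]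
  · rw [volume_pi, Measure.restrict_pi_pi, integral_fintype_prod_eq_prod]
  · intro i _
    exact integral_nonneg (h0 i)
  · exact Integrable.integrableOn (Integrable.fintype_prod hi)
  · exact ae_of_all _ fun y => prod_nonneg fun i _ => h0 i _

section
variable {M n k : ℕ} {f : Fin M → ℝ → ℝ} (hf_meas : ∀ a, Measurable (f a))
    (hf_nonneg : ∀ a t, 0 ≤ f a t) (hf_int : ∀ a, ∫ t, f a t = 1) (x : ℕ → Fin M)

lemma f_integrable (hf_int : ∀ a, ∫ t, f a t = 1) (a : Fin M) : Integrable (f a) := by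
  by_contra h
  have := hf_int a
  rw [integral_undef h] at this
  exact zero_ne_one this

lemma prob_f (hf_nonneg : ∀ a t, 0 ≤ f a t) (hf_int : ∀ a, ∫ t, f a t = 1) (a : Fin M) :
    IsProbabilityMeasure ((volume : Measure ℝ).withDensity fun t => ENNReal.ofReal (f a t)) := by
  constructor
  rw [withDensity_apply _ MeasurableSet.univ, Measure.restrict_univ,
    ← ofReal_integral_eq_lintegral_ofReal (f_integrable hf_int a) (ae_of_all _ (hf_nonneg a)),
    hf_int]
  simp

lemma window_meas (i : ℕ) : Measurable (fun y : Fin n → ℝ => window k (ext y) i) := by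
  refine measurable_pi_lambda _ fun j => ?_
  unfold window ext
  by_cases h : i - k + j.val < n
  · simp only [h, dite_true]; fun_prop
  · simp only [h, dite_false]; fun_prop

lemma indep_coord (hf_nonneg : ∀ a t, 0 ≤ f a t) (hf_int : ∀ a, ∫ t, f a t = 1) :
    iIndepFun (fun (i : Fin n) (y : Fin n → ℝ) => y i) (lawSeq n f x) := by
  have := prob_f hf_nonneg hf_int
  unfold lawSeq
  exact iIndepFun_pi (X := fun _ t => t) (fun i => measurable_id.aemeasurable)

lemma lawSeq_prob (hf_nonneg : ∀ a t, 0 ≤ f a t) (hf_int : ∀ a, ∫ t, f a t = 1) :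
    IsProbabilityMeasure (lawSeq n f x) := by
  have := prob_f hf_nonneg hf_int
  unfold lawSeq
  infer_instance

lemma window_eq (i : ℕ) (hi : i ∈ Finset.Ico k (n - k)) (y : Fin n → ℝ) (j : Fin (2*k+1))
    (h : i - k + j.val < n) :
    window k (ext y) i j = y ⟨i - k + j.val, h⟩ := by
  simp [window, ext, h]

lemma window_law (hf_nonneg : ∀ a t, 0 ≤ f a t) (hf_int : ∀ a, ∫ t, f a t = 1)
    (i : ℕ) (hi : i ∈ Finset.Ico k (n - k)) :
    (lawSeq n f x).map (fun y => window k (ext y) i)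
      = Measure.pi fun j : Fin (2*k+1) =>
        volume.withDensity fun t => ENNReal.ofReal (f (x (i - k + j.val)) t) := by
  have hp := prob_f hf_nonneg hf_int
  have hlt : ∀ j : Fin (2*k+1), i - k + j.val < n := by
    intro j; have := j.2; rw [Finset.mem_Ico] at hi; omega
  have hind := (indep_coord (n := n) x hf_nonneg hf_int).precomp
    (g := fun j : Fin (2*k+1) => (⟨i - k + j.val, hlt j⟩ : Fin n))
    (by intro a b hab; simp only [Fin.mk.injEq] at hab; ext; omega)
  have e : (fun y : Fin n → ℝ => window k (ext y) i)
      = fun y (j : Fin (2*k+1)) => y ⟨i - k + j.val, hlt j⟩ := by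
    funext y j; exact window_eq i hi y j (hlt j)
  rw [e, hind.map_fun_eq_pi_map (fun j => (measurable_pi_apply _).aemeasurable)]
  congr 1
  funext j
  exact (measurePreserving_eval (fun i : Fin n => (volume : Measure ℝ).withDensity
    fun t => ENNReal.ofReal (f (x i.val) t)) ⟨i - k + j.val, hlt j⟩).map_eq

lemma window_integral (hf_meas : ∀ a, Measurable (f a))
    (hf_nonneg : ∀ a t, 0 ≤ f a t) (hf_int : ∀ a, ∫ t, f a t = 1)
    (i : ℕ) (hi : i ∈ Finset.Ico k (n - k)) (F : (Fin (2*k+1) → ℝ) → ℝ) (hF : Measurable F) :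
    ∫ y, F (window k (ext y) i) ∂(lawSeq n f x)
      = ∫ y : Fin (2*k+1) → ℝ, F y * ∏ j, f (x (i - k + j.val)) (y j) := by
  rw [← integral_map (φ := fun y : Fin n → ℝ => window k (ext y) i)
    (window_meas i).aemeasurable hF.aestronglyMeasurable,
    window_law x hf_nonneg hf_int i hi, pi_wd _ (fun _ => hf_meas _) (fun _ => hf_nonneg _)
      (fun _ => f_integrable hf_int _),
    integral_withDensity_eq_integral_toReal_smul (by fun_prop) (by simp)]
  refine integral_congr_ae (ae_of_all _ fun y => ?_)
  simp only [smul_eq_mul]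
  rw [ENNReal.toReal_ofReal (prod_nonneg fun j _ => hf_nonneg _ _), mul_comm]

/-- windows in one residue class are independent -/
lemma window_indep (hf_nonneg : ∀ a t, 0 ≤ f a t) (hf_int : ∀ a, ∫ t, f a t = 1)
    (m : ℕ) (hm : n - 2*k = (2*k+1) * m) (hn : 2*k < n) (r : ℕ) (hr : r < 2*k+1) :
    iIndepFun (fun (q : Fin m) (y : Fin n → ℝ) => window k (ext y) (k + (r + (2*k+1) * q.val)))
      (lawSeq n f x) := by
  have hlt : ∀ (q : Fin m) (j : Fin (2*k+1)), r + (2*k+1) * q.val + j.val < n := by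
    intro q j
    have hq := q.2
    have hj := j.2
    have : (2*k+1) * (q.val + 1) ≤ (2*k+1) * m := Nat.mul_le_mul_left _ hq
    rw [mul_add] at this
    omega
  have hind := (indep_coord (n := n) x hf_nonneg hf_int).precomp
    (g := fun p : (_ : Fin m) × Fin (2*k+1) =>
      (⟨r + (2*k+1) * p.1.val + p.2.val, hlt p.1 p.2⟩ : Fin n))
    (by
      rintro ⟨q, j⟩ ⟨q', j'⟩ hab
      simp only [Fin.mk.injEq] at hab
      have h1 : (2*k+1) * q.val + j.val = (2*k+1) * q'.val + j'.val := by omega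
      have hq : q = q' := by
        have := congrArg (· / (2*k+1)) h1
        simp only [Nat.mul_add_div (Nat.succ_pos (2*k)), Nat.div_eq_of_lt j.2,
          Nat.div_eq_of_lt j'.2] at this
        ext; omega
      subst hq
      have hj : j = j' := by ext; omega
      subst hj
      rfl)
  have h2 := indep_curry (X := fun (q : Fin m) (j : Fin (2*k+1)) (y : Fin n → ℝ) =>
    y ⟨r + (2*k+1) * q.val + j.val, hlt q j⟩) (by fun_prop) hind
  convert h2 using 3 with q y
  funext j
  simp only [window, ext]
  have e : k + (r + (2*k+1) * q.val) - k = r + (2*k+1) * q.val := by omega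
  simp only [e, hlt q j, dite_true]
end

lemma sum_split {k m n : ℕ} (hm : n - 2*k = (2*k+1) * m) (hn : 2*k < n) (G : ℕ → ℝ) :
    ∑ i ∈ Finset.Ico k (n - k), G i
      = ∑ r : Fin (2*k+1), ∑ q : Fin m, G (k + (r.val + (2*k+1) * q.val)) := by
  rw [Finset.sum_Ico_eq_sum_range]
  have e : n - k - k = m * (2*k+1) := by rw [mul_comm, ← hm]; omega
  rw [e, ← Fin.sum_univ_eq_sum_range (fun i => G (k + i)),
    ← finProdFinEquiv.sum_comp, Fintype.sum_prod_type, Finset.sum_comm]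
  rfl

lemma lam_meas {M : ℕ} {ι : Type*} [MeasurableSpace ι] (Λ : Matrix (Fin M) (Fin M) ℝ) (a : Fin M)
    {h : ι → Fin M} (hh : Measurable h) : Measurable (fun y => Λ a (h y)) :=
  (measurable_of_countable (fun b => Λ a b)).comp hh

lemma conc {M n k : ℕ} {f : Fin M → ℝ → ℝ} (hn : 2*k < n) (hdiv : (2*k+1) ∣ (n - 2*k))
    (hf_nonneg : ∀ a t, 0 ≤ f a t) (hf_int : ∀ a, ∫ t, f a t = 1) (x : ℕ → Fin M)
    (Λ : Matrix (Fin M) (Fin M) ℝ) (Λmax : ℝ) (hΛmax : 0 < Λmax)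
    (hΛ : ∀ a b, Λ a b ∈ Set.Icc 0 Λmax)
    (h : (Fin (2*k+1) → ℝ) → Fin M) (hh : Measurable h) (t : ℝ) (ht : 0 < t) :
    (lawSeq n f x).real {y : Fin n → ℝ |
        t < |avgLoss n k Λ x h y - ∫ y', avgLoss n k Λ x h y' ∂(lawSeq n f x)|}
      ≤ 2 * (2*k+1) * Real.exp (-(2 * ((n - 2*k : ℕ) : ℝ) / (2*k+1)) * t^2 / Λmax^2) := by
  have hP := lawSeq_prob (n := n) x hf_nonneg hf_int
  obtain ⟨m, hm⟩ := hdiv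
  have hm0 : 0 < m := by
    rcases Nat.eq_zero_or_pos m with h0 | h0
    · subst h0; simp at hm; omega
    · exact h0
  set μ := lawSeq n f x with hμ
  set Z : ℕ → (Fin n → ℝ) → ℝ := fun i y => Λ (x i) (h (window k (ext y) i)) with hZ
  have hZm : ∀ i, Measurable (Z i) := fun i => lam_meas Λ (x i) (hh.comp (window_meas i))
  have hZi : ∀ i, Integrable (Z i) μ := fun i =>
    Integrable.of_mem_Icc 0 Λmax (hZm i).aemeasurable (ae_of_all _ fun y => hΛ _ _)
  set W : ℕ → (Fin n → ℝ) → ℝ := fun i y => Z i y - ∫ y', Z i y' ∂μ with hW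
  have hkm : ((n - 2*k : ℕ) : ℝ) = (2*k+1) * m := by rw [hm]; push_cast; ring
  have hmR : (0:ℝ) < m := by exact_mod_cast hm0
  have hkR : (0:ℝ) < 2*k+1 := by positivity
  have hdiff : ∀ y, avgLoss n k Λ x h y - ∫ y', avgLoss n k Λ x h y' ∂μ
      = ((2*k+1) * (m:ℝ))⁻¹ *
        ∑ r : Fin (2*k+1), ∑ q : Fin m, W (k + (r.val + (2*k+1) * q.val)) y := by
    intro y
    unfold avgLoss
    rw [integral_const_mul, integral_finsetSum _ (fun i _ => hZi i), ← mul_sub,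
      ← Finset.sum_sub_distrib, sum_split hm hn, hkm]
  set S : Fin (2*k+1) → (Fin n → ℝ) → ℝ :=
    fun r y => ∑ q : Fin m, W (k + (r.val + (2*k+1) * q.val)) y with hS
  set E := Real.exp (-(2 * ((n - 2*k : ℕ) : ℝ) / (2*k+1)) * t^2 / Λmax^2) with hE
  have hexp : ∀ c : NNReal, c = (‖Λmax - 0‖₊ / 2) ^ 2 →
      Real.exp (-(m * t)^2 / (2 * ((∑ q : Fin m, c : NNReal) : ℝ))) = E := by
    intro c hc
    rw [hE, hkm]
    congr 1
    simp only [Finset.sum_const, Finset.card_univ, Fintype.card_fin, nsmul_eq_mul, hc]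
    push_cast
    rw [Real.norm_eq_abs, sub_zero, abs_of_pos hΛmax]
    field_simp
  have hind : ∀ r : Fin (2*k+1),
      iIndepFun (fun (q : Fin m) => W (k + (r.val + (2*k+1) * q.val))) μ := by
    intro r
    exact (window_indep x hf_nonneg hf_int m hm hn r.val r.2).comp
      (fun q w => Λ (x (k + (r.val + (2*k+1) * q.val))) (h w)
        - ∫ y', Z (k + (r.val + (2*k+1) * q.val)) y' ∂μ)
      (fun q => (lam_meas Λ _ hh).sub_const _)
  have hsub : ∀ i, HasSubgaussianMGF (W i) ((‖Λmax - 0‖₊ / 2) ^ 2) μ := fun i =>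
    hasSubgaussianMGF_of_mem_Icc (hZm i).aemeasurable (ae_of_all _ fun y => hΛ _ _)
  have hup : ∀ r, μ.real {y | m * t ≤ S r y} ≤ E := by
    intro r
    have := HasSubgaussianMGF.measure_sum_ge_le_of_iIndepFun (hind r) (s := Finset.univ)
      (c := fun _ => (‖Λmax - 0‖₊ / 2) ^ 2) (fun q _ => hsub _) (ε := m * t) (by positivity)
    rw [hexp _ rfl] at this
    exact this
  have hlo : ∀ r, μ.real {y | m * t ≤ - S r y} ≤ E := by
    intro r
    have hneg : iIndepFun (fun (q : Fin m) => - W (k + (r.val + (2*k+1) * q.val))) μ :=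
      (hind r).comp (fun _ z => -z) (fun _ => measurable_neg)
    have := HasSubgaussianMGF.measure_sum_ge_le_of_iIndepFun hneg (s := Finset.univ)
      (c := fun _ => (‖Λmax - 0‖₊ / 2) ^ 2) (fun q _ => (hsub _).neg) (ε := m * t) (by positivity)
    rw [hexp _ rfl] at this
    simpa [hS, Finset.sum_neg_distrib] using this
  have hsubset : {y : Fin n → ℝ |
        t < |avgLoss n k Λ x h y - ∫ y', avgLoss n k Λ x h y' ∂μ|}
      ⊆ ⋃ r : Fin (2*k+1), ({y | m * t ≤ S r y} ∪ {y | m * t ≤ - S r y}) := by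
    intro y hy
    by_contra hcon
    simp only [Set.mem_iUnion, Set.mem_union, Set.mem_ofPred_eq, not_exists, not_or, not_le] at hcon
    have hlt : ∀ r ∈ (Finset.univ : Finset (Fin (2*k+1))), |S r y| ≤ m * t := fun r _ => by
      rw [abs_le]; constructor <;> linarith [(hcon r).1, (hcon r).2]
    have h1 : |∑ r, S r y| ≤ (2*k+1) * (m * t) := by
      refine (Finset.abs_sum_le_sum_abs _ _).trans ((Finset.sum_le_sum hlt).trans ?_)
      simp
    have h2 : t < |avgLoss n k Λ x h y - ∫ y', avgLoss n k Λ x h y' ∂μ| := hy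
    rw [hdiff, abs_mul, abs_of_pos (by positivity), inv_mul_eq_div, lt_div_iff₀ (by positivity)] at h2
    change _ < |∑ r, S r y| at h2
    linarith
  calc _ ≤ μ.real (⋃ r : Fin (2*k+1), ({y | m * t ≤ S r y} ∪ {y | m * t ≤ - S r y})) :=
        measureReal_mono hsubset
    _ ≤ ∑ r : Fin (2*k+1), μ.real ({y | m * t ≤ S r y} ∪ {y | m * t ≤ - S r y}) :=
        measureReal_iUnion_fintype_le _
    _ ≤ ∑ r : Fin (2*k+1), (E + E) := Finset.sum_le_sum fun r _ =>
        (measureReal_union_le _ _).trans (add_le_add (hup r) (hlo r))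
    _ = _ := by simp; ring

lemma emp_sum {M n k : ℕ} (x : ℕ → Fin M) (F : (Fin (2*k+1) → Fin M) → ℝ) :
    ∑ u, empDist M n k x u * F u
      = ((n - 2*k : ℕ) : ℝ)⁻¹ * ∑ i ∈ Finset.Ico k (n - k), F (fun j => x (i - k + j.val)) := by
  unfold empDist
  simp_rw [Finset.card_filter, Nat.cast_sum, div_eq_inv_mul, mul_assoc, ← Finset.mul_sum,
    Finset.sum_mul]
  rw [Finset.sum_comm]
  congr 1
  refine Finset.sum_congr rfl fun i _ => ?_
  rw [Finset.sum_eq_single (fun j : Fin (2*k+1) => x (i - k + j.val))]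
  · simp
  · intro u _ hu
    have : ¬ ∀ j : Fin (2*k+1), x (i - k + j.val) = u j := fun hall => hu (funext fun j => (hall j).symm)
    simp [this]
  · simp

section bias
variable {M k : ℕ} {f : Fin M → ℝ → ℝ} {P : (Fin (2*k+1) → Fin M) → ℝ}

lemma prod_integrable (hf_int : ∀ a, ∫ t, f a t = 1) (u : Fin (2*k+1) → Fin M) :
    Integrable (fun y : Fin (2*k+1) → ℝ => ∏ j, f (u j) (y j)) :=
  Integrable.fintype_prod (f := fun j => f (u j)) fun j => f_integrable hf_int (u j)

lemma prod_integral (hf_int : ∀ a, ∫ t, f a t = 1) (u : Fin (2*k+1) → Fin M) :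
    ∫ y : Fin (2*k+1) → ℝ, ∏ j, f (u j) (y j) = 1 := by
  rw [integral_fintype_prod_volume_eq_prod (fun j => f (u j))]
  simp [hf_int]

lemma prod_center (u : Fin (2*k+1) → Fin M) (y : Fin (2*k+1) → ℝ) :
    ∏ j, f (u j) (y j)
      = f (u (center k)) (y (center k)) * ∏ i, f (dropCenter k u i) (dropCenter k y i) :=
  Fin.prod_univ_succAbove (fun j => f (u j) (y j)) (center k)

lemma pJoint_eq (a : Fin M) (y : Fin (2*k+1) → ℝ) :
    pJoint f P a y = pJointCtx f P a (dropCenter k y) * f a (y (center k)) := by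
  unfold pJoint pJointCtx
  rw [Finset.sum_mul]
  refine Finset.sum_congr rfl fun u _ => ?_
  split_ifs with hu
  · rw [prod_center, hu]; ring
  · simp

lemma sum_pJoint (F : Fin M → ℝ) (y : Fin (2*k+1) → ℝ) :
    ∑ a, F a * pJoint f P a y = ∑ u, P u * (F (u (center k)) * ∏ j, f (u j) (y j)) := by
  unfold pJoint
  simp_rw [Finset.mul_sum]
  rw [Finset.sum_comm]
  refine Finset.sum_congr rfl fun u _ => ?_
  simp
  ring

lemma sum_pJoint_one (y : Fin (2*k+1) → ℝ) : ∑ a, pJoint f P a y = pFull f P y := by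
  simpa [pFull] using sum_pJoint (f := f) (P := P) (fun _ => 1) y

lemma sum_pJointCtx (c : Fin (2*k) → ℝ) : ∑ a, pJointCtx f P a c = pCtx f P c := by
  unfold pJointCtx pCtx
  rw [Finset.sum_comm]
  simp

lemma pJointCtx_nonneg (hf : ∀ a t, 0 ≤ f a t) (hP : ∀ u, 0 ≤ P u) (a : Fin M)
    (c : Fin (2*k) → ℝ) : 0 ≤ pJointCtx f P a c := by
  refine Finset.sum_nonneg fun u _ => ?_
  split_ifs
  · exact mul_nonneg (hP u) (prod_nonneg fun _ _ => hf _ _)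
  · exact le_rfl

lemma pCtx_f_eq (a : Fin M) (y : Fin (2*k+1) → ℝ) :
    pCtx f P (dropCenter k y) * f a (y (center k))
      = ∑ u, P u * ∏ j, f (Function.update u (center k) a j) (y j) := by
  unfold pCtx
  rw [Finset.sum_mul]
  refine Finset.sum_congr rfl fun u _ => ?_
  rw [prod_center]
  have : dropCenter k (Function.update u (center k) a) = dropCenter k u := by
    funext i
    simp [dropCenter, Fin.succAbove_ne]
  rw [this]
  simp
  ring

lemma mix_integrable (hf_int : ∀ a, ∫ t, f a t = 1)
    (φ : (Fin (2*k+1) → Fin M) → (Fin (2*k+1) → Fin M)) :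
    Integrable (fun y : Fin (2*k+1) → ℝ => ∑ u, P u * ∏ j, f (φ u j) (y j)) :=
  integrable_finsetSum _ fun u _ => (prod_integrable hf_int (φ u)).const_mul _

lemma mix_integral (hf_int : ∀ a, ∫ t, f a t = 1) (hP1 : ∑ u, P u = 1)
    (φ : (Fin (2*k+1) → Fin M) → (Fin (2*k+1) → Fin M)) :
    ∫ y : Fin (2*k+1) → ℝ, ∑ u, P u * ∏ j, f (φ u j) (y j) = 1 := by
  rw [integral_finsetSum _ fun u _ => (prod_integrable hf_int (φ u)).const_mul _]
  simp_rw [integral_const_mul, prod_integral hf_int, mul_one]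
  exact hP1

lemma term_integrable (hf_int : ∀ a, ∫ t, f a t = 1)
    (Λ : Matrix (Fin M) (Fin M) ℝ) (Λmax : ℝ) (hΛ : ∀ a b, Λ a b ∈ Set.Icc 0 Λmax)
    {h : (Fin (2*k+1) → ℝ) → Fin M} (hh : Measurable h) (a : Fin M) (u : Fin (2*k+1) → Fin M) :
    Integrable (fun y : Fin (2*k+1) → ℝ => Λ a (h y) * ∏ j, f (u j) (y j)) := by
  refine (prod_integrable hf_int u).bdd_mul (c := Λmax)
    (lam_meas Λ a hh).aestronglyMeasurable (ae_of_all _ fun y => ?_)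
  rw [Real.norm_eq_abs, abs_of_nonneg (hΛ _ _).1]
  exact (hΛ _ _).2

lemma risk_integrable (hf_int : ∀ a, ∫ t, f a t = 1)
    (Λ : Matrix (Fin M) (Fin M) ℝ) (Λmax : ℝ) (hΛ : ∀ a b, Λ a b ∈ Set.Icc 0 Λmax)
    {h : (Fin (2*k+1) → ℝ) → Fin M} (hh : Measurable h) :
    Integrable (fun y : Fin (2*k+1) → ℝ => ∑ a, Λ a (h y) * pJoint f P a y) := by
  simp_rw [fun y => sum_pJoint (f := f) (P := P) (fun a => Λ a (h y)) y]
  exact integrable_finsetSum _ fun u _ => (term_integrable hf_int Λ Λmax hΛ hh _ u).const_mul _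

lemma risk_eq (hf_int : ∀ a, ∫ t, f a t = 1)
    (Λ : Matrix (Fin M) (Fin M) ℝ) (Λmax : ℝ) (hΛ : ∀ a b, Λ a b ∈ Set.Icc 0 Λmax)
    {h : (Fin (2*k+1) → ℝ) → Fin M} (hh : Measurable h) :
    risk f P Λ h = ∫ y : Fin (2*k+1) → ℝ, ∑ a, Λ a (h y) * pJoint f P a y := by
  simp_rw [fun y => sum_pJoint (f := f) (P := P) (fun a => Λ a (h y)) y]
  rw [integral_finsetSum _ fun u _ => (term_integrable hf_int Λ Λmax hΛ hh _ u).const_mul _]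
  simp_rw [integral_const_mul]
  rfl

lemma round_near (N : ℕ) (hN : 0 < N) (δ : ℝ) (hδ : δ = 1 / N) (v : ℝ) (hv : v ∈ Set.Icc (0:ℝ) 1) :
    ∃ m : ℕ, m ≤ N ∧ |m * δ - v| ≤ δ / 2 := by
  have hNR : (0:ℝ) < N := by exact_mod_cast hN
  have h0 : 0 ≤ v * N + 1/2 := by have := mul_nonneg hv.1 hNR.le; linarith
  have hle := Nat.floor_le h0
  have hlt := Nat.lt_floor_add_one (v * N + 1/2)
  refine ⟨⌊v * N + 1/2⌋₊, ?_, ?_⟩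
  · have : v * N ≤ N := by nlinarith [hv.2]
    have h1 : ((⌊v * N + 1/2⌋₊ : ℕ) : ℝ) < ((N + 1 : ℕ) : ℝ) := by push_cast; linarith
    have := Nat.cast_lt.1 h1
    omega
  · have e : (⌊v * N + 1/2⌋₊ : ℝ) * δ - v = ((⌊v * N + 1/2⌋₊ : ℝ) - v * N) * δ := by
      rw [hδ]; field_simp
    have hδ0 : 0 < δ := by rw [hδ]; positivity
    rw [e, abs_mul, abs_of_pos hδ0]
    have : |(⌊v * N + 1/2⌋₊ : ℝ) - v * N| ≤ 1/2 := by
      rw [abs_le]; constructor <;> linarith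
    nlinarith

lemma pointwise (hf_nonneg : ∀ a t, 0 ≤ f a t) (hP : ∀ u, 0 ≤ P u)
    (Pi : Matrix (Fin M) (Fin M) ℝ) (hPi_inv : IsUnit Pi.det)
    (Λ : Matrix (Fin M) (Fin M) ℝ) (Λmax : ℝ) (hΛmax : 0 < Λmax)
    (hΛ : ∀ a b, Λ a b ∈ Set.Icc 0 Λmax)
    (g : (Fin (2*k) → ℝ) → Fin M → ℝ) (ε' : ℝ) (hε' : 0 < ε')
    (hg_approx : ∀ c : Fin (2*k) → ℝ, 0 < pCtx f P c → ∑ z, |PZ f P Pi c z - g c z| ≤ ε')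
    (hhat_range : ∀ y : Fin (2*k+1) → ℝ, 0 < pFull f P y →
      ∀ a, postHat f P Pi g y a ∈ Set.Icc (0:ℝ) 1)
    (N : ℕ) (hN : 0 < N) (δ : ℝ) (hδ : δ = 1 / N)
    (Rδ : (Fin M → ℝ) → (Fin M → ℝ))
    (hR_near : ∀ v : Fin M → ℝ, (∀ i, v i ∈ Set.Icc (0:ℝ) 1) →
      ∀ i, ∀ m : ℕ, m ≤ N → |Rδ v i - v i| ≤ |m * δ - v i|)
    (y : Fin (2*k+1) → ℝ) (b b' : Fin M)
    (hb : 0 < pFull f P y → IsBayes Λ (Rδ (postHat f P Pi g y)) b) :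
    ∑ a, Λ a b * pJoint f P a y ≤ ∑ a, Λ a b' * pJoint f P a y
      + (Λmax * ∑ a, ε' * Real.sqrt (∑ z, (Pi⁻¹ z a)^2) *
          (pCtx f P (dropCenter k y) * f a (y (center k)))
        + Λmax * (M * δ / 2) * pFull f P y) := by
  set s : Fin M → ℝ := fun a => Real.sqrt (∑ z, (Pi⁻¹ z a)^2) with hs
  have hδ0 : 0 < δ := by rw [hδ]; positivity
  have hJC := fun a => pJointCtx_nonneg hf_nonneg hP a (dropCenter k y)
  have hC0 : 0 ≤ pCtx f P (dropCenter k y) := by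
    rw [← sum_pJointCtx]; exact Finset.sum_nonneg fun a _ => hJC a
  have hJ : ∀ a, 0 ≤ pJoint f P a y := fun a => by
    rw [pJoint_eq]; exact mul_nonneg (hJC a) (hf_nonneg _ _)
  have hF0 : 0 ≤ pFull f P y := by
    rw [← sum_pJoint_one]; exact Finset.sum_nonneg fun a _ => hJ a
  have hB1 : 0 ≤ ∑ a, ε' * s a * (pCtx f P (dropCenter k y) * f a (y (center k))) :=
    Finset.sum_nonneg fun a _ => mul_nonneg (mul_nonneg hε'.le (Real.sqrt_nonneg _))
      (mul_nonneg hC0 (hf_nonneg _ _))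
  rcases hF0.eq_or_lt with hF | hF
  · have hz : ∀ a, pJoint f P a y = 0 := by
      have h1 := sum_pJoint_one (f := f) (P := P) y
      rw [← hF, Finset.sum_eq_zero_iff_of_nonneg (fun a _ => hJ a)] at h1
      exact fun a => h1 a (Finset.mem_univ a)
    simp only [hz, mul_zero, Finset.sum_const_zero, ← hF, add_zero, zero_add]
    exact mul_nonneg hΛmax.le hB1
  have hC : 0 < pCtx f P (dropCenter k y) := by
    rcases hC0.eq_or_lt with h0 | h0
    · exfalso
      have h1 := sum_pJointCtx (f := f) (P := P) (dropCenter k y)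
      rw [← h0, Finset.sum_eq_zero_iff_of_nonneg (fun a _ => hJC a)] at h1
      have h2 := sum_pJoint_one (f := f) (P := P) y
      simp_rw [pJoint_eq, fun a => h1 a (Finset.mem_univ a)] at h2
      simp at h2
      linarith
    · exact h0
  set C := pCtx f P (dropCenter k y) with hCdef
  set F := pFull f P y with hFdef
  set w := postHat f P Pi g y with hw
  set v := Rδ w with hv
  have hwr := hhat_range y hF
  -- the posterior recovered from `PZ`
  have hpost : ∀ a, ∑ z, PZ f P Pi (dropCenter k y) z * Pi⁻¹ z a
      = postCtx f P (dropCenter k y) a := by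
    intro a
    have e : PZ f P Pi (dropCenter k y) = Matrix.vecMul (postCtx f P (dropCenter k y)) Pi := rfl
    have e2 : ∑ z, PZ f P Pi (dropCenter k y) z * Pi⁻¹ z a
      = Matrix.vecMul (PZ f P Pi (dropCenter k y)) Pi⁻¹ a := rfl
    rw [e2, e, Matrix.vecMul_vecMul, Matrix.mul_nonsing_inv _ hPi_inv, Matrix.vecMul_one]
  have hq : ∀ a, |pJoint f P a y - F * w a| ≤ ε' * s a * (C * f a (y (center k))) := by
    intro a
    have e1 : pJoint f P a y
        = (∑ z, PZ f P Pi (dropCenter k y) z * Pi⁻¹ z a) * (C * f a (y (center k))) := by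
      rw [hpost, pJoint_eq]
      simp only [postCtx]
      rw [← hCdef]
      field_simp
    have e2 : F * w a = (∑ z, g (dropCenter k y) z * Pi⁻¹ z a) * (C * f a (y (center k))) := by
      simp only [hw, postHat]
      rw [← hCdef, ← hFdef]
      field_simp
    rw [e1, e2, ← sub_mul, abs_mul, abs_of_nonneg (mul_nonneg hC0 (hf_nonneg _ _)),
      ← Finset.sum_sub_distrib]
    refine mul_le_mul_of_nonneg_right ?_ (mul_nonneg hC0 (hf_nonneg _ _))
    calc _ ≤ ∑ z, |PZ f P Pi (dropCenter k y) z * Pi⁻¹ z a - g (dropCenter k y) z * Pi⁻¹ z a| :=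
          Finset.abs_sum_le_sum_abs _ _
      _ ≤ ∑ z, |PZ f P Pi (dropCenter k y) z - g (dropCenter k y) z| * s a := by
          refine Finset.sum_le_sum fun z _ => ?_
          rw [← sub_mul, abs_mul]
          refine mul_le_mul_of_nonneg_left ?_ (abs_nonneg _)
          rw [hs]
          refine Real.abs_le_sqrt ?_
          exact Finset.single_le_sum (f := fun z => (Pi⁻¹ z a)^2) (fun z _ => sq_nonneg _)
            (Finset.mem_univ z)
      _ ≤ ε' * s a := by
          rw [← Finset.sum_mul]
          exact mul_le_mul_of_nonneg_right (hg_approx _ hC) (Real.sqrt_nonneg _)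
  have hvw : ∀ a, |v a - w a| ≤ δ / 2 := by
    intro a
    obtain ⟨m, hm, hm2⟩ := round_near N hN δ hδ (w a) (hwr a)
    exact (hR_near w hwr a m hm).trans hm2
  have hbay : ∑ a, (Λ a b - Λ a b') * v a ≤ 0 := by
    have := hb hF b'
    simp_rw [sub_mul, Finset.sum_sub_distrib]
    linarith
  have hD : ∀ a, |Λ a b - Λ a b'| ≤ Λmax := by
    intro a
    have h1 := hΛ a b
    have h2 := hΛ a b'
    rw [abs_le]; constructor <;> linarith [h1.1, h1.2, h2.1, h2.2]
  have hterm : ∀ a ∈ (Finset.univ : Finset (Fin M)), (Λ a b - Λ a b') * pJoint f P a y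
      ≤ Λmax * (ε' * s a * (C * f a (y (center k)))) + Λmax * (δ / 2) * F
        + F * ((Λ a b - Λ a b') * v a) := by
    intro a _
    have t1 : (Λ a b - Λ a b') * (pJoint f P a y - F * w a)
        ≤ Λmax * (ε' * s a * (C * f a (y (center k)))) :=
      (le_abs_self _).trans (by
        rw [abs_mul]; exact mul_le_mul (hD a) (hq a) (abs_nonneg _) hΛmax.le)
    have t2 : (Λ a b - Λ a b') * (w a - v a) ≤ Λmax * (δ / 2) :=
      (le_abs_self _).trans (by
        rw [abs_mul, abs_sub_comm (w a)]
        exact mul_le_mul (hD a) (hvw a) (abs_nonneg _) hΛmax.le)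
    nlinarith [mul_le_mul_of_nonneg_right t2 hF.le]
  have hsum := Finset.sum_le_sum hterm
  rw [Finset.sum_add_distrib, Finset.sum_add_distrib, ← Finset.mul_sum, ← Finset.mul_sum] at hsum
  simp only [Finset.sum_const, Finset.card_univ, Fintype.card_fin, nsmul_eq_mul] at hsum
  simp_rw [sub_mul, Finset.sum_sub_distrib] at hsum
  simp_rw [sub_mul, Finset.sum_sub_distrib] at hbay
  have hfin := mul_nonpos_of_nonneg_of_nonpos hF.le hbay
  rw [← Finset.mul_sum, Finset.sum_sub_distrib] at hsum
  change _ ≤ _ + (Λmax * ∑ a, ε' * s a * (C * f a (y (center k))) + _)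
  linarith
end bias

lemma avg_eq_risk {M n k : ℕ} {f : Fin M → ℝ → ℝ} (hf_meas : ∀ a, Measurable (f a))
    (hf_nonneg : ∀ a t, 0 ≤ f a t) (hf_int : ∀ a, ∫ t, f a t = 1) (x : ℕ → Fin M)
    (Λ : Matrix (Fin M) (Fin M) ℝ) (Λmax : ℝ)
    (hΛ : ∀ a b, Λ a b ∈ Set.Icc 0 Λmax)
    {h : (Fin (2*k+1) → ℝ) → Fin M} (hh : Measurable h) :
    ∫ y, avgLoss n k Λ x h y ∂(lawSeq n f x) = risk f (empDist M n k x) Λ h := by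
  have hP := lawSeq_prob (n := n) x hf_nonneg hf_int
  unfold avgLoss risk
  rw [emp_sum, integral_const_mul, integral_finsetSum]
  · congr 1
    refine Finset.sum_congr rfl fun i hi => ?_
    rw [window_integral x hf_meas hf_nonneg hf_int i hi (fun w => Λ (x i) (h w)) (lam_meas Λ _ hh)]
    have : i - k + (center k).val = i := by
      rw [Finset.mem_Ico] at hi; simp [center]; omega
    beta_reduce
    rw [this]
  · intro i _
    exact Integrable.of_mem_Icc 0 Λmax
      (lam_meas Λ (x i) (hh.comp (window_meas i))).aemeasurable (ae_of_all _ fun y => hΛ _ _)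

/-- Theorem 1 of the paper, main theorem: with `P = P^k_{x^n}`, under
Assumption 2 (with `ε* = ε′ Σ_a ‖π_a^{-1}‖₂`), for the Gen-CUDE denoiser `X̂^δ` given by a
measurable Bayes-response rule for the quantized approximate posterior `R_δ(P̂)`, for every
`ε > Λ_max (3ε* + Mδ/2)`:
`Pr(|L_{X̂^δ}(x^n,Y^n) − D^k_{x^n}| > ε)
  ≤ 2(2k+1)(1/δ+1)^M exp(−(2(n−2k)/(2k+1)) (ε − Λ_max(3ε* + Mδ/2))² / Λ_max²)`. -/
theorem statement13
    (M n k : ℕ) (hM : 2 ≤ M) (hk : 1 ≤ k) (hn : 2*k < n)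
    (hdiv : (2*k+1) ∣ (n - 2*k))
    (f : Fin M → ℝ → ℝ) (hf_meas : ∀ a, Measurable (f a))
    (hf_nonneg : ∀ a t, 0 ≤ f a t) (hf_int : ∀ a, ∫ t, f a t = 1)
    (Q : ℝ → Fin M) (hQ : Measurable Q)
    (Pi : Matrix (Fin M) (Fin M) ℝ)
    (hPi : ∀ a z, Pi a z = ∫ t in {s : ℝ | Q s = z}, f a t)
    (hPi_inv : IsUnit Pi.det)
    (Λ : Matrix (Fin M) (Fin M) ℝ) (Λmax : ℝ) (hΛmax : 0 < Λmax)
    (hΛ : ∀ a b, Λ a b ∈ Set.Icc 0 Λmax)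
    (x : ℕ → Fin M)
    (g : (Fin (2*k) → ℝ) → Fin M → ℝ) (hg_meas : Measurable g)
    (hg_simplex : ∀ c, (∀ z, 0 ≤ g c z) ∧ ∑ z, g c z = 1)
    (ε' : ℝ) (hε' : 0 < ε')
    (hg_approx : ∀ c : Fin (2*k) → ℝ, 0 < pCtx f (empDist M n k x) c →
      ∑ z, |PZ f (empDist M n k x) Pi c z - g c z| ≤ ε')
    (hhat_range : ∀ y : Fin (2*k+1) → ℝ, 0 < pFull f (empDist M n k x) y →
      ∀ a, postHat f (empDist M n k x) Pi g y a ∈ Set.Icc (0:ℝ) 1)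
    (N : ℕ) (hN : 0 < N) (δ : ℝ) (hδ : δ = 1 / N)
    (Rδ : (Fin M → ℝ) → (Fin M → ℝ))
    (hR_grid : ∀ v : Fin M → ℝ, (∀ i, v i ∈ Set.Icc (0:ℝ) 1) →
      ∀ i, ∃ m : ℕ, m ≤ N ∧ Rδ v i = m * δ)
    (hR_near : ∀ v : Fin M → ℝ, (∀ i, v i ∈ Set.Icc (0:ℝ) 1) →
      ∀ i, ∀ m : ℕ, m ≤ N → |Rδ v i - v i| ≤ |m * δ - v i|)
    (hhatδ : (Fin (2*k+1) → ℝ) → Fin M) (hhatδ_meas : Measurable hhatδ)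
    (hhatδ_bayes : ∀ y : Fin (2*k+1) → ℝ, 0 < pFull f (empDist M n k x) y →
      IsBayes Λ (Rδ (postHat f (empDist M n k x) Pi g y)) (hhatδ y))
    (ε : ℝ)
    (hε : Λmax * (3 * (ε' * ∑ a, Real.sqrt (∑ z, (Pi⁻¹ z a)^2)) + M * δ / 2) < ε) :
    lawSeq n f x {y : Fin n → ℝ |
        ε < |avgLoss n k Λ x hhatδ y
          - ⨅ gk : {g' : (Fin (2*k+1) → ℝ) → Fin M // Measurable g'},
              ∫ y' : Fin n → ℝ, avgLoss n k Λ x gk.1 y' ∂(lawSeq n f x)|}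
      ≤ ENNReal.ofReal (2 * (2*k+1) * (1/δ + 1)^M *
          Real.exp (-(2 * ((n - 2*k : ℕ) : ℝ) / (2*k+1)) *
            (ε - Λmax * (3 * (ε' * ∑ a, Real.sqrt (∑ z, (Pi⁻¹ z a)^2)) + M * δ / 2))^2
            / Λmax^2)) := by
  have hP : ∀ u, 0 ≤ empDist M n k x u := fun u => by unfold empDist; positivity
  have hnk : ((n - 2*k : ℕ) : ℝ) ≠ 0 := by
    have : n - 2*k ≠ 0 := by omega
    exact_mod_cast this
  have hP1 : ∑ u, empDist M n k x u = 1 := by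
    have := emp_sum (M := M) (n := n) (k := k) x (fun _ => 1)
    simp only [mul_one, Finset.sum_const, Nat.card_Ico, nsmul_eq_mul] at this
    rw [this, show n - k - k = n - 2*k by omega, inv_mul_cancel₀ hnk]
  have hprob := lawSeq_prob (n := n) x hf_nonneg hf_int
  have hδ0 : 0 < δ := by rw [hδ]; positivity
  set s : Fin M → ℝ := fun a => Real.sqrt (∑ z, (Pi⁻¹ z a)^2) with hs
  have hs0 : 0 ≤ ε' * ∑ a, s a :=
    mul_nonneg hε'.le (Finset.sum_nonneg fun a _ => Real.sqrt_nonneg _)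
  set P := empDist M n k x with hPdef
  set bias := Λmax * (3 * (ε' * ∑ a, s a) + M * δ / 2) with hbias
  have hrisk : ∀ g' : (Fin (2*k+1) → ℝ) → Fin M, Measurable g' →
      risk f P Λ hhatδ ≤ risk f P Λ g' + bias := by
    intro g' hg'
    have iC : ∀ a, Integrable (fun y : Fin (2*k+1) → ℝ =>
        pCtx f P (dropCenter k y) * f a (y (center k))) := by
      intro a
      simp_rw [pCtx_f_eq]
      exact mix_integrable hf_int (fun u => Function.update u (center k) a)
    have vC : ∀ a, ∫ y : Fin (2*k+1) → ℝ,
        pCtx f P (dropCenter k y) * f a (y (center k)) = 1 := by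
      intro a
      simp_rw [pCtx_f_eq]
      exact mix_integral hf_int hP1 (fun u => Function.update u (center k) a)
    have iF : Integrable (fun y : Fin (2*k+1) → ℝ => pFull f P y) :=
      mix_integrable hf_int (fun u => u)
    have vF : ∫ y : Fin (2*k+1) → ℝ, pFull f P y = 1 := mix_integral hf_int hP1 (fun u => u)
    have iS : Integrable (fun y : Fin (2*k+1) → ℝ =>
        Λmax * ∑ a, ε' * s a * (pCtx f P (dropCenter k y) * f a (y (center k)))) :=
      (integrable_finsetSum _ fun a _ => (iC a).const_mul _).const_mul _
    have iB := iS.add (iF.const_mul (Λmax * (M * δ / 2)))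
    have vB : ∫ y : Fin (2*k+1) → ℝ,
        (Λmax * ∑ a, ε' * s a * (pCtx f P (dropCenter k y) * f a (y (center k)))
          + Λmax * (M * δ / 2) * pFull f P y)
        = Λmax * (ε' * ∑ a, s a) + Λmax * (M * δ / 2) := by
      rw [integral_add iS (iF.const_mul _), integral_const_mul, integral_const_mul, vF,
        integral_finsetSum _ (fun a _ => (iC a).const_mul _)]
      simp_rw [integral_const_mul, vC, mul_one]
      rw [← Finset.mul_sum]
    rw [risk_eq hf_int Λ Λmax hΛ hhatδ_meas, risk_eq hf_int Λ Λmax hΛ hg']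
    have iR := risk_integrable (P := P) hf_int Λ Λmax hΛ hg'
    have hmono := integral_mono (risk_integrable (P := P) hf_int Λ Λmax hΛ hhatδ_meas)
      (iR.add iB) (fun y => pointwise hf_nonneg hP Pi hPi_inv Λ Λmax hΛmax hΛ g ε' hε' hg_approx
        hhat_range N hN δ hδ Rδ hR_near y (hhatδ y) (g' y) (hhatδ_bayes y))
    have e := integral_add iR iB
    have e2 : ∫ y, (((fun y : Fin (2*k+1) → ℝ =>
        Λmax * ∑ a, ε' * s a * (pCtx f P (dropCenter k y) * f a (y (center k))))
          + fun y => Λmax * (M * δ / 2) * pFull f P y) y)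
        = Λmax * (ε' * ∑ a, s a) + Λmax * (M * δ / 2) := vB
    rw [e2] at e
    have hmono2 := hmono.trans e.le
    refine hmono2.trans ?_
    rw [hbias]
    have := mul_nonneg hΛmax.le hs0
    linarith
  set L := ∫ y', avgLoss n k Λ x hhatδ y' ∂(lawSeq n f x) with hL
  have hLr : L = risk f P Λ hhatδ := avg_eq_risk hf_meas hf_nonneg hf_int x Λ Λmax hΛ hhatδ_meas
  set D := ⨅ gk : {g' : (Fin (2*k+1) → ℝ) → Fin M // Measurable g'},
              ∫ y' : Fin n → ℝ, avgLoss n k Λ x gk.1 y' ∂(lawSeq n f x) with hD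
  have hne : Nonempty {g' : (Fin (2*k+1) → ℝ) → Fin M // Measurable g'} := ⟨⟨hhatδ, hhatδ_meas⟩⟩
  have hlow : L - bias ≤ D := by
    refine le_ciInf fun gk => ?_
    rw [avg_eq_risk hf_meas hf_nonneg hf_int x Λ Λmax hΛ gk.2, hLr]
    linarith [hrisk gk.1 gk.2]
  have hbdd : BddBelow (Set.range fun gk : {g' : (Fin (2*k+1) → ℝ) → Fin M // Measurable g'} =>
      ∫ y' : Fin n → ℝ, avgLoss n k Λ x gk.1 y' ∂(lawSeq n f x)) := by
    refine ⟨L - bias, ?_⟩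
    rintro _ ⟨gk, rfl⟩
    change L - bias ≤ ∫ y' : Fin n → ℝ, avgLoss n k Λ x gk.1 y' ∂(lawSeq n f x)
    rw [avg_eq_risk hf_meas hf_nonneg hf_int x Λ Λmax hΛ gk.2, hLr]
    linarith [hrisk gk.1 gk.2]
  have hupp : D ≤ L := ciInf_le hbdd ⟨hhatδ, hhatδ_meas⟩
  have hc := conc hn hdiv hf_nonneg hf_int x Λ Λmax hΛmax hΛ hhatδ hhatδ_meas (ε - bias)
    (by linarith)
  have hfac : (1:ℝ) ≤ (1/δ + 1)^M := one_le_pow₀ (by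
    have : 0 < 1/δ := by positivity
    linarith)
  have hsub : {y : Fin n → ℝ | ε < |avgLoss n k Λ x hhatδ y - D|}
      ⊆ {y : Fin n → ℝ | ε - bias < |avgLoss n k Λ x hhatδ y - L|} := by
    intro y hy
    have hy' : ε < |avgLoss n k Λ x hhatδ y - D| := hy
    change ε - bias < |avgLoss n k Λ x hhatδ y - L|
    have h1 : |avgLoss n k Λ x hhatδ y - D| ≤ |avgLoss n k Λ x hhatδ y - L| + |L - D| :=
      abs_sub_le _ _ _
    have h2 : |L - D| ≤ bias := by rw [abs_of_nonneg (by linarith)]; linarith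
    linarith
  refine (measure_mono hsub).trans ?_
  rw [← ofReal_measureReal]
  refine ENNReal.ofReal_le_ofReal (hc.trans ?_)
  refine mul_le_mul_of_nonneg_right ?_ (Real.exp_pos _).le
  exact le_mul_of_one_le_right (by positivity) hfac

end GenCUDE
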